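/- arXiv:2504.18907 — 2 statements merged into one kernel-verified Lean document; each statement's English description precedes it below -/
import Mathlib

section
/- The equation t = e·ln(e + t) has a unique positive solution t₀. Setting κ = e/(e + t₀), for every ε with 0 < ε < κ there exists a constant a ≥ 1 such that for all real numbers 0 < s < t one has φ(t)/t^{2+ε} ≤ a·φ(s)/s^{2+ε}; that is, φ(t) = t²·ln(e + t) satisfies the almost-decreasing condition (aDec)_{2+ε}. Equivalently, for 0 < ε < κ the function t ↦ t^ε/ln(e + t) is almost increasing on (0,∞): there exists a ≥ 1 with s^ε/ln(e + s) ≤ a·t^ε/ln(e + t) whenever 0 < s < t. -/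
open Real Filter Topology

/-- The growth of `ln (e + t)` is slower than that of `t ^ ε`, in a form uniform in `0 < s < t`. -/
theorem log_exp_one_add_mul_rpow_le {ε s t : ℝ} (hε : 0 < ε) (hs : 0 < s) (hst : s < t) :
    Real.log (Real.exp 1 + t) * s ^ ε ≤ (1 + 1 / ε) * (Real.log (Real.exp 1 + s) * t ^ ε) := by
  have ht : 0 < t := hs.trans hst
  have he : 0 < Real.exp 1 := Real.exp_pos 1
  have hlog : 1 ≤ Real.log (Real.exp 1 + s) := by
    rw [Real.le_log_iff_exp_le (by positivity)]
    linarith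
  have hsplit : Real.log (Real.exp 1 + t) ≤ Real.log (Real.exp 1 + s) + Real.log (t / s) := by
    rw [← Real.log_mul (by positivity) (by positivity)]
    apply Real.log_le_log (by positivity)
    rw [mul_div_assoc', le_div_iff₀ hs]
    nlinarith
  have hdiv : Real.log (t / s) ≤ (t / s) ^ ε / ε := Real.log_le_rpow_div (by positivity) hε
  rw [Real.div_rpow ht.le hs.le] at hdiv
  have hsε : 0 < s ^ ε := Real.rpow_pos_of_pos hs ε
  have htε : 0 < t ^ ε := Real.rpow_pos_of_pos ht ε
  have hmono : s ^ ε ≤ t ^ ε := Real.rpow_le_rpow hs.le hst.le hε.le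
  calc Real.log (Real.exp 1 + t) * s ^ ε
      ≤ (Real.log (Real.exp 1 + s) + t ^ ε / s ^ ε / ε) * s ^ ε := by gcongr; linarith
    _ = Real.log (Real.exp 1 + s) * s ^ ε + 1 * (t ^ ε / ε) := by field_simp
    _ ≤ Real.log (Real.exp 1 + s) * t ^ ε + Real.log (Real.exp 1 + s) * (t ^ ε / ε) := by gcongr
    _ = (1 + 1 / ε) * (Real.log (Real.exp 1 + s) * t ^ ε) := by ring

theorem strictMonoOn_sub_exp_one_mul_log :
    StrictMonoOn (fun t : ℝ => t - Real.exp 1 * Real.log (Real.exp 1 + t)) (Set.Ioi 0) := by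
  intro s hs t ht hst
  rw [Set.mem_Ioi] at hs ht
  have he : 0 < Real.exp 1 := Real.exp_pos 1
  have hlog : Real.log ((Real.exp 1 + t) / (Real.exp 1 + s)) ≤
      (Real.exp 1 + t) / (Real.exp 1 + s) - 1 := Real.log_le_sub_one_of_pos (by positivity)
  rw [Real.log_div (by positivity) (by positivity)] at hlog
  have hlt : Real.exp 1 * ((Real.exp 1 + t) / (Real.exp 1 + s) - 1) < t - s := by
    rw [div_sub_one (by positivity), mul_div_assoc', div_lt_iff₀ (by positivity)]
    nlinarith
  have := mul_le_mul_of_nonneg_left hlog he.le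
  dsimp only
  linarith

theorem existsUnique_pos_eq_exp_one_mul_log :
    ∃! t : ℝ, 0 < t ∧ t = Real.exp 1 * Real.log (Real.exp 1 + t) := by
  have he : 2 < Real.exp 1 := by linarith [Real.exp_one_gt_d9]
  have hcube : Real.exp 3 = Real.exp 1 ^ 3 := by rw [← Real.exp_nat_mul]; norm_num
  have hT : 0 ≤ Real.exp 3 - Real.exp 1 - Real.exp 1 * 3 := by
    rw [hcube]
    nlinarith [mul_pos (sub_pos.2 he) (by linarith : 0 < Real.exp 1),
      mul_pos (mul_pos (sub_pos.2 he) (sub_pos.2 he)) (by linarith : 0 < Real.exp 1)]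
  have hcont : ContinuousOn (fun t : ℝ => t - Real.exp 1 * Real.log (Real.exp 1 + t))
      (Set.Icc 0 (Real.exp 3 - Real.exp 1)) := by
    refine continuousOn_id.sub (continuousOn_const.mul (ContinuousOn.log (by fun_prop) ?_))
    intro x hx
    linarith [hx.1]
  obtain ⟨t, ht, h⟩ := intermediate_value_Icc (by linarith) hcont
    (show (0 : ℝ) ∈ Set.Icc _ _ from ⟨by simp [Real.exp_nonneg], by simpa using hT⟩)
  dsimp only at h
  have htpos : 0 < t := by
    refine lt_of_le_of_ne ht.1 ?_
    rintro rfl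
    simp at h
  refine ⟨t, ⟨htpos, sub_eq_zero.1 h⟩, ?_⟩
  rintro y ⟨hy, hyeq⟩
  exact strictMonoOn_sub_exp_one_mul_log.injOn hy htpos ((sub_eq_zero.2 hyeq).trans h.symm)

/-- the equation `t = e·ln(e + t)` has a unique positive solution `t₀`,
and for `κ = e/(e + t₀)` and any `0 < ε < κ`, the function
`φ(t) = t² ln(e + t)` satisfies (aDec)_{2+ε} with some constant `a ≥ 1`;
equivalently `t ↦ t^ε / ln(e + t)` is almost increasing on `(0,∞)`. -/
theorem phi_aDec_two_add_eps :
    (∃! t₀ : ℝ, 0 < t₀ ∧ t₀ = Real.exp 1 * Real.log (Real.exp 1 + t₀)) ∧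
    (∀ t₀ : ℝ, 0 < t₀ → t₀ = Real.exp 1 * Real.log (Real.exp 1 + t₀) →
      ∀ ε : ℝ, 0 < ε → ε < Real.exp 1 / (Real.exp 1 + t₀) →
        ∃ a : ℝ, 1 ≤ a ∧
          (∀ s t : ℝ, 0 < s → s < t →
            (t ^ 2 * Real.log (Real.exp 1 + t)) / t ^ ((2 : ℝ) + ε) ≤
              a * ((s ^ 2 * Real.log (Real.exp 1 + s)) / s ^ ((2 : ℝ) + ε))) ∧
          (∀ s t : ℝ, 0 < s → s < t →
            s ^ ε / Real.log (Real.exp 1 + s) ≤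
              a * (t ^ ε / Real.log (Real.exp 1 + t)))) := by
  refine ⟨existsUnique_pos_eq_exp_one_mul_log, ?_⟩
  intro _ _ _ ε hε _
  refine ⟨1 + 1 / ε, le_add_of_nonneg_right (by positivity), ?_, ?_⟩
  · intro s t hs hst
    have ht : 0 < t := hs.trans hst
    have hsε : 0 < s ^ ε := Real.rpow_pos_of_pos hs ε
    have htε : 0 < t ^ ε := Real.rpow_pos_of_pos ht ε
    rw [Real.rpow_add hs, Real.rpow_add ht, Real.rpow_two, Real.rpow_two,
      mul_div_mul_left _ _ (by positivity), mul_div_mul_left _ _ (by positivity),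
      mul_div_assoc', div_le_div_iff₀ htε hsε, mul_assoc (1 + 1 / ε)]
    exact log_exp_one_add_mul_rpow_le hε hs hst
  · intro s t hs hst
    have log_pos : ∀ x : ℝ, 0 < x → 0 < Real.log (Real.exp 1 + x) := fun x hx =>
      Real.log_pos (by linarith [Real.exp_one_gt_d9])
    rw [mul_div_assoc', div_le_div_iff₀ (log_pos s hs) (log_pos t (hs.trans hst))]
    linarith [log_exp_one_add_mul_rpow_le hε hs hst]
end

section
/- Let N ≥ 1, Ω ⊂ ℝ^N a bounded domain, β > 0, and let p : [0,1/4] → ℝ be C¹ with p(0) = β. Let a : [0,1/4] × Ω → ℝ be measurable in x, with s ↦ a(s,x) of class C¹ on [0,1/4] for a.e. x, a(0,x) = 1 for a.e. x ∈ Ω, and a and ∂_s a uniformly bounded on [0,1/4] × Ω. Then for every φ ∈ C_c^∞(Ω): lim_{s→0⁺} (1/s)·(∫_Ω a(s,x)·|φ(x)|^{p(s)} dx − ∫_Ω |φ(x)|^β dx) = ∫_Ω (∂_s a(0,x) + p′(0)·ln|φ(x)|)·|φ(x)|^β dx, where the integrand is interpreted as 0 at points where φ(x) = 0. Equivalently,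 ∫_Ω a(s,x)|φ|^{p(s)} dx = ∫_Ω |φ|^β dx + s·∫_Ω (∂_s a(0,x) + p′(0)·ln|φ|)|φ|^β dx + o(s) as s → 0⁺. -/
open MeasureTheory Real Filter Topology

noncomputable section

/-- Euclidean space `ℝ^N`. -/
abbrev Rn (N : ℕ) := EuclideanSpace ℝ (Fin N)

/-- Lipschitz dependence of `t ^ q` on the exponent `q ∈ [c, R]`, uniformly for `t ∈ [0, M]`. -/
theorem abs_rpow_sub_rpow_le {c R M t q r : ℝ} (hc : 0 < c) (hM : 1 ≤ M) (ht : 0 ≤ t)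
    (htM : t ≤ M) (hq : q ∈ Set.Icc c R) (hr : r ∈ Set.Icc c R) :
    |t ^ q - t ^ r| ≤ (1 / c + M * M ^ R) * |q - r| := by
  have hMR : 0 ≤ M * M ^ R := by positivity
  rcases ht.eq_or_lt with rfl | ht
  · rw [zero_rpow (hc.trans_le hq.1).ne', zero_rpow (hc.trans_le hr.1).ne', sub_self, abs_zero]
    positivity
  have hbound : ∀ y ∈ Set.Icc c R, ‖t ^ y * Real.log t‖ ≤ 1 / c + M * M ^ R := by
    intro y hy
    have hy0 : 0 < y := hc.trans_le hy.1
    rw [Real.norm_eq_abs]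
    rcases le_total t 1 with h1 | h1
    · have h := (abs_log_mul_self_rpow_lt t y ht h1 hy0).le
      rw [mul_comm] at h
      have : 1 / y ≤ 1 / c := one_div_le_one_div_of_le hc hy.1
      linarith
    · have hlog : Real.log t ≤ M := (Real.log_le_self ht.le).trans htM
      have hpow : t ^ y ≤ M ^ R :=
        (rpow_le_rpow ht.le htM hy0.le).trans (rpow_le_rpow_of_exponent_le hM hy.2)
      rw [abs_of_nonneg (mul_nonneg (by positivity) (Real.log_nonneg h1)), mul_comm]
      have := mul_le_mul hlog hpow (by positivity) (by linarith)
      have : 0 < 1 / c := by positivity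
      linarith
  have := (convex_Icc c R).norm_image_sub_le_of_norm_hasDerivWithin_le
    (fun y _ => ((Real.hasStrictDerivAt_const_rpow ht y).hasDerivAt).hasDerivWithinAt) hbound hr hq
  simpa only [Real.norm_eq_abs] using this

/-- The one-sided derivative at `0` of `s ↦ b s * t ^ p s`. -/
theorem tendsto_mul_rpow_sub_div {b p : ℝ → ℝ} {b' p' β t : ℝ} (hβ : 0 < β) (ht : 0 ≤ t)
    (hb : HasDerivWithinAt b b' (Set.Ioi 0) 0) (hp : HasDerivWithinAt p p' (Set.Ioi 0) 0)
    (hb0 : b 0 = 1) (hp0 : p 0 = β) :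
    Tendsto (fun s => (b s * t ^ p s - t ^ β) / s) (𝓝[>] 0)
      (𝓝 ((b' + p' * Real.log t) * t ^ β)) := by
  rcases ht.eq_or_lt with rfl | ht
  · rw [zero_rpow hβ.ne', mul_zero]
    have hpos : ∀ᶠ s in 𝓝[>] (0 : ℝ), 0 < p s :=
      hp.continuousWithinAt.eventually (lt_mem_nhds (by rwa [hp0]))
    refine tendsto_const_nhds.congr' ?_
    filter_upwards [hpos] with s hs
    rw [zero_rpow hs.ne']
    simp
  · have h := (hasDerivWithinAt_iff_tendsto_slope' (by simp)).1 (hb.mul (hp.const_rpow ht))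
    have e : b' * t ^ p 0 + b 0 * (Real.log t * p' * t ^ p 0)
        = (b' + p' * Real.log t) * t ^ β := by
      rw [hp0, hb0]; ring
    rw [e] at h
    refine h.congr fun s => ?_
    simp [slope_def_field, hb0, hp0]

/-- first-order expansion of the weighted nonlinear term: for
`φ ∈ C_c^∞(Ω)`,
`∫_Ω a(s,x)|φ|^{p(s)} = ∫_Ω |φ|^β + s ∫_Ω (∂_s a(0,x) + p'(0) ln|φ|)|φ|^β + o(s)`
as `s → 0⁺`. -/
theorem weighted_term_first_order_expansion
    (N : ℕ) (hN : 1 ≤ N) (Ω : Set (Rn N))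
    (hΩopen : IsOpen Ω) (hΩbdd : Bornology.IsBounded Ω)
    (β : ℝ) (hβ : 0 < β)
    (p : ℝ → ℝ) (hpC1 : ContDiffOn ℝ 1 p (Set.Icc 0 (1 / 4))) (hp0 : p 0 = β)
    (a : ℝ → Rn N → ℝ)
    (hameas : ∀ s ∈ Set.Icc (0 : ℝ) (1 / 4), Measurable (a s))
    (haC1 : ∀ᵐ x ∂(volume.restrict Ω),
      ContDiffOn ℝ 1 (fun s => a s x) (Set.Icc 0 (1 / 4)))
    (ha0 : ∀ᵐ x ∂(volume.restrict Ω), a 0 x = 1)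
    (habdd : ∃ C : ℝ, ∀ s ∈ Set.Icc (0 : ℝ) (1 / 4), ∀ x ∈ Ω,
      |a s x| ≤ C ∧ |derivWithin (fun s => a s x) (Set.Icc 0 (1 / 4)) s| ≤ C)
    (φ : Rn N → ℝ) (hφsmooth : ContDiff ℝ (⊤ : ℕ∞) φ)
    (hφsupp : HasCompactSupport φ) (hφΩ : tsupport φ ⊆ Ω) :
    Tendsto (fun s : ℝ =>
        ((∫ x in Ω, a s x * |φ x| ^ p s) - ∫ x in Ω, |φ x| ^ β) / s)
      (nhdsWithin 0 (Set.Ioi 0))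
      (nhds (∫ x in Ω,
        (derivWithin (fun s => a s x) (Set.Icc 0 (1 / 4)) 0 +
          derivWithin p (Set.Icc (0 : ℝ) (1 / 4)) 0 * Real.log |φ x|) * |φ x| ^ β)) := by
  obtain ⟨C, hC⟩ := habdd
  set I : Set ℝ := Set.Icc 0 (1 / 4) with hI
  have h0I : (0 : ℝ) ∈ I := by constructor <;> norm_num
  have hIoi : I ∈ 𝓝[>] (0 : ℝ) := Icc_mem_nhdsGT (by norm_num)
  have toIoi {f : ℝ → ℝ} (hf : ContDiffOn ℝ 1 f I) :
      HasDerivWithinAt f (derivWithin f I 0) (Set.Ioi 0) 0 :=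
    ((hf.differentiableOn (by norm_num)) 0 h0I).hasDerivWithinAt.mono_of_mem_nhdsWithin hIoi
  have hp' := toIoi hpC1
  obtain ⟨M₀, hM₀⟩ := hφsupp.exists_bound_of_continuous hφsmooth.continuous
  obtain ⟨M, hM1, hM⟩ : ∃ M : ℝ, 1 ≤ M ∧ ∀ x, |φ x| ≤ M :=
    ⟨max 1 M₀, le_max_left _ _, fun x => (hM₀ x).trans (le_max_right _ _)⟩
  set L := |derivWithin p I 0| + 1
  have hslope : ∀ᶠ s in 𝓝[>] (0 : ℝ), |p s - β| ≤ L * s := by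
    have h := ((hasDerivWithinAt_iff_tendsto_slope' (by simp)).1 hp').abs
    filter_upwards [h.eventually (gt_mem_nhds (lt_add_one _)), self_mem_nhdsWithin] with s hs hs0
    have hs0 : 0 < s := hs0
    rw [slope_def_field, hp0, sub_zero, abs_div, abs_of_pos hs0, div_lt_iff₀ hs0] at hs
    exact hs.le
  have hpnear : ∀ᶠ s in 𝓝[>] (0 : ℝ), p s ∈ Set.Icc (β / 2) (2 * β) :=
    hp'.continuousWithinAt.eventually
      (by rw [hp0]; exact Icc_mem_nhds (by linarith) (by linarith))
  have hβmem : β ∈ Set.Icc (β / 2) (2 * β) := ⟨by linarith, by linarith⟩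
  have hpow (x : Rn N) {q : ℝ} (hq : q ∈ Set.Icc (β / 2) (2 * β)) :
      |φ x| ^ q ≤ M ^ (2 * β) :=
    (rpow_le_rpow (abs_nonneg _) (hM x) (by linarith [hq.1])).trans
      (rpow_le_rpow_of_exponent_le hM1 hq.2)
  have hmpow (q : ℝ) : Measurable fun x => |φ x| ^ q :=
    (hφsmooth.continuous.abs.measurable).pow_const q
  have : IsFiniteMeasure (volume.restrict Ω) :=
    isFiniteMeasure_restrict.2 hΩbdd.measure_lt_top.ne
  have hΩae : ∀ᵐ x ∂(volume.restrict Ω), x ∈ Ω := ae_restrict_mem hΩopen.measurableSet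
  have hint₀ : Integrable (fun x => |φ x| ^ β) (volume.restrict Ω) :=
    .of_bound (hmpow β).aestronglyMeasurable (M ^ (2 * β)) <| .of_forall fun x => by
      rw [Real.norm_eq_abs, abs_of_nonneg (by positivity)]
      exact hpow x hβmem
  have hintegral : ∀ᶠ s in 𝓝[>] (0 : ℝ),
      (∫ x in Ω, (a s x * |φ x| ^ p s - |φ x| ^ β) / s) =
        ((∫ x in Ω, a s x * |φ x| ^ p s) - ∫ x in Ω, |φ x| ^ β) / s := by
    filter_upwards [hpnear, hIoi] with s hps hs
    rw [integral_div, integral_sub _ hint₀]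
    refine .of_bound ((hameas s hs).mul (hmpow _)).aestronglyMeasurable (C * M ^ (2 * β)) ?_
    filter_upwards [hΩae] with x hx
    have hCx := (hC s hs x hx).1
    rw [Real.norm_eq_abs, abs_mul, abs_of_nonneg (a := |φ x| ^ p s) (by positivity)]
    exact mul_le_mul hCx (hpow x hps) (by positivity) ((abs_nonneg _).trans hCx)
  refine Tendsto.congr' hintegral ?_
  refine tendsto_integral_filter_of_dominated_convergence
    (fun _ => C * M ^ (2 * β) + (1 / (β / 2) + M * M ^ (2 * β)) * L) ?_ ?_
    (integrable_const _) ?_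
  · filter_upwards [hIoi] with s hs
    exact ((((hameas s hs).mul (hmpow _)).sub (hmpow _)).div_const s).aestronglyMeasurable
  · filter_upwards [hpnear, hslope, hIoi, self_mem_nhdsWithin] with s hps hsl hs hs0
    have hs0 : 0 < s := hs0
    filter_upwards [hΩae, haC1, ha0] with x hx hax hax0
    have hlip : |a s x - 1| ≤ C * s := by
      have h := (convex_Icc (0 : ℝ) (1 / 4)).norm_image_sub_le_of_norm_derivWithin_le
        (hax.differentiableOn (by norm_num)) (fun r hr => (hC r hr x hx).2) h0I hs
      simpa [hax0, abs_of_pos hs0] using h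
    have hexp := abs_rpow_sub_rpow_le (by linarith : 0 < β / 2) hM1 (abs_nonneg (φ x)) (hM x)
      hps hβmem
    have hK : 0 ≤ 1 / (β / 2) + M * M ^ (2 * β) := by positivity
    rw [Real.norm_eq_abs, abs_div, abs_of_pos hs0, div_le_iff₀ hs0]
    calc |a s x * |φ x| ^ p s - |φ x| ^ β|
        = |(a s x - 1) * |φ x| ^ p s + (|φ x| ^ p s - |φ x| ^ β)| := by congr 1; ring
      _ ≤ |(a s x - 1) * |φ x| ^ p s| + |(|φ x| ^ p s - |φ x| ^ β)| := abs_add_le _ _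
      _ ≤ C * s * M ^ (2 * β) + (1 / (β / 2) + M * M ^ (2 * β)) * (L * s) := by
        rw [abs_mul, abs_of_nonneg (a := |φ x| ^ p s) (by positivity)]
        exact add_le_add
          (mul_le_mul hlip (hpow x hps) (by positivity) ((abs_nonneg _).trans hlip))
          (hexp.trans (mul_le_mul_of_nonneg_left hsl hK))
      _ = _ := by ring
  · filter_upwards [haC1, ha0] with x hax hax0
    exact tendsto_mul_rpow_sub_div hβ (abs_nonneg _) (toIoi hax) hp' hax0 hp0
end
end
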